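/- (Correctness of the peeling algorithm for quark decomposition.) Let H = (V, E) be a finite hypergraph with |V| = n and let v_1, v_2, …, v_n be an ordering of V such that for every i, the node v_i has minimum degree in the induced hypergraph H|_{S_i}, where S_i = {v_i, v_{i+1}, …, v_n}. Then for every i, the quark number of v_i satisfies K(v_i) = max_{j ≤ i} d_{S_j}(v_j), where d_{S_j}(v_j) is the degree of v_j in H|_{S_j}. In other words, greedily peeling a minimum-degree node at each step and recording the running maximum of the peeled degrees computes all quark numbers. -/

import Mathlib

variable {V : Type*}

/-- Degree of node `v` in the hypergraph with hyperedge set `E` induced on `S`: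
the number of hyperedges contained in `S` that contain `v`. -/
def hdeg [DecidableEq V] (E : Finset (Finset V)) (S : Finset V) (v : V) : ℕ :=
  (E.filter fun e => v ∈ e ∧ e ⊆ S).card

/-- Nodes `u` and `v` are connected in the hypergraph induced on `S`:
there is a nonempty sequence of hyperedges of `H|_S` starting at an edge containing `u`,
ending at an edge containing `v`, with consecutive edges intersecting. -/
def HConn [DecidableEq V] (E : Finset (Finset V)) (S : Finset V) (u v : V) : Prop :=
  ∃ (l : List (Finset V)) (hl : l ≠ []),
    (∀ e ∈ l, e ∈ E ∧ e ⊆ S) ∧ u ∈ l.head hl ∧ v ∈ l.getLast hl ∧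
    l.Chain' fun e f => (e ∩ f).Nonempty

/-- The hypergraph induced on `S` is connected. -/
def ConnectedOn [DecidableEq V] (E : Finset (Finset V)) (S : Finset V) : Prop :=
  ∀ u ∈ S, ∀ v ∈ S, HConn E S u v

/-- `S` is a `k`-quark: the induced hypergraph is connected, has minimum degree at least `k`,
and `S` is maximal with these two properties. -/
def IsQuark [DecidableEq V] (E : Finset (Finset V)) (k : ℕ) (S : Finset V) : Prop :=
  ConnectedOn E S ∧ (∀ v ∈ S, k ≤ hdeg E S v) ∧
    ∀ T : Finset V, S ⊆ T → ConnectedOn E T → (∀ v ∈ T, k ≤ hdeg E T v) → T = S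

/-- The quark number of `u`: the largest `k` such that `u` belongs to a nonempty `k`-quark. -/
noncomputable def quarkNum [DecidableEq V] (E : Finset (Finset V)) (u : V) : ℕ :=
  sSup {k : ℕ | ∃ S : Finset V, IsQuark E k S ∧ u ∈ S}

section Hypergraph

variable [DecidableEq V] {E : Finset (Finset V)} {S T : Finset V} {u v w : V}

theorem hdeg_mono (h : S ⊆ T) (v : V) : hdeg E S v ≤ hdeg E T v :=
  Finset.card_le_card fun e he => by
    rw [Finset.mem_filter] at he ⊢
    exact ⟨he.1, he.2.1, he.2.2.trans h⟩

theorem HConn.of_mem {e : Finset V} (he : e ∈ E) (heS : e ⊆ S) (hu : u ∈ e) (hv : v ∈ e) :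
    HConn E S u v :=
  ⟨[e], by simp, by simpa using ⟨he, heS⟩, by simpa, by simpa, List.isChain_singleton e⟩

theorem HConn.symm (h : HConn E S u v) : HConn E S v u := by
  obtain ⟨l, hl, hE, hu, hv, hc⟩ := h
  refine ⟨l.reverse, by simpa, by simpa using hE, by simpa, by simpa, ?_⟩
  refine List.isChain_reverse.2 ?_
  exact hc.imp fun a b hab => by rwa [Finset.inter_comm]

theorem HConn.trans (huv : HConn E S u v) (hvw : HConn E S v w) : HConn E S u w := by
  obtain ⟨l, hl, hE, hu, hv, hc⟩ := huv
  obtain ⟨m, hm, hE', hv', hw, hc'⟩ := hvw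
  refine ⟨l ++ m, by simp [hl], ?_, ?_, ?_, ?_⟩
  · intro e he
    rcases List.mem_append.1 he with he | he
    exacts [hE e he, hE' e he]
  · rwa [List.head_append_of_ne_nil hl]
  · rwa [List.getLast_append_of_ne_nil _ hm]
  · refine List.IsChain.append hc hc' fun a ha b hb => ?_
    rw [List.getLast?_eq_getLast_of_ne_nil hl, Option.mem_some_iff] at ha
    rw [List.head?_eq_some_head hm, Option.mem_some_iff] at hb
    subst ha hb
    exact ⟨v, Finset.mem_inter.2 ⟨hv, hv'⟩⟩

theorem subset_of_isChain_of_head (hT : ∀ e ∈ E, e ⊆ S → (e ∩ T).Nonempty → e ⊆ T) :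
    ∀ (l : List (Finset V)) (hl : l ≠ []), (∀ e ∈ l, e ∈ E ∧ e ⊆ S) →
      (l.head hl ∩ T).Nonempty → l.IsChain (fun e f => (e ∩ f).Nonempty) → ∀ e ∈ l, e ⊆ T
  | [], hl, _, _, _ => absurd rfl hl
  | [a], _, hE, hh, _ => by
    have ha := hE a (by simp)
    simpa using hT a ha.1 ha.2 hh
  | a :: b :: l, _, hE, hh, hc => by
    have ha := hE a (by simp)
    have haT : a ⊆ T := hT a ha.1 ha.2 hh
    rw [List.isChain_cons_cons] at hc
    have hb : (b ∩ T).Nonempty := by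
      obtain ⟨x, hx⟩ := hc.1
      rw [Finset.mem_inter] at hx
      exact ⟨x, Finset.mem_inter.2 ⟨hx.2, haT hx.1⟩⟩
    have ih := subset_of_isChain_of_head hT (b :: l) (by simp)
      (fun e he => hE e (List.mem_cons_of_mem _ he)) hb hc.2
    intro e he
    rcases List.mem_cons.1 he with rfl | he
    exacts [haT, ih e he]

/-- A walk in `H|_S` starting in a union `T` of connected components stays in `T`. -/
theorem HConn.restrict (h : HConn E S u v)
    (hT : ∀ e ∈ E, e ⊆ S → (e ∩ T).Nonempty → e ⊆ T) (hu : u ∈ T) : HConn E T u v := by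
  obtain ⟨l, hl, hE, hul, hv, hc⟩ := h
  have hsub := subset_of_isChain_of_head hT l hl hE ⟨u, Finset.mem_inter.2 ⟨hul, hu⟩⟩ hc
  exact ⟨l, hl, fun e he => ⟨(hE e he).1, hsub e he⟩, hul, hv, hc⟩

theorem exists_connectedOn_of_le_hdeg {k : ℕ} (hk : 0 < k) (hS : ∀ w ∈ S, k ≤ hdeg E S w)
    (hu : u ∈ S) : ∃ C, u ∈ C ∧ ConnectedOn E C ∧ ∀ w ∈ C, k ≤ hdeg E C w := by
  classical
  let C := S.filter fun w => HConn E S u w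
  have hC : ∀ e ∈ E, e ⊆ S → (e ∩ C).Nonempty → e ⊆ C := by
    rintro e he heS ⟨w, hw⟩ z hz
    obtain ⟨hwe, hwC⟩ := Finset.mem_inter.1 hw
    exact Finset.mem_filter.2
      ⟨heS hz, (Finset.mem_filter.1 hwC).2.trans (.of_mem he heS hwe hz)⟩
  have huC : u ∈ C := by
    obtain ⟨e, he⟩ := Finset.card_pos.1 (hk.trans_le (hS u hu))
    rw [Finset.mem_filter] at he
    exact Finset.mem_filter.2 ⟨hu, .of_mem he.1 he.2.2 he.2.1 he.2.1⟩
  have hconn : ∀ w ∈ C, HConn E C u w := fun w hw =>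
    (Finset.mem_filter.1 hw).2.restrict hC huC
  refine ⟨C, huC, fun a ha b hb => (hconn a ha).symm.trans (hconn b hb), fun w hw => ?_⟩
  refine (hS w (Finset.mem_filter.1 hw).1).trans (Finset.card_le_card fun e he => ?_)
  rw [Finset.mem_filter] at he ⊢
  exact ⟨he.1, he.2.1, hC e he.1 he.2.2 ⟨w, Finset.mem_inter.2 ⟨he.2.1, hw⟩⟩⟩

theorem exists_isQuark_superset [Finite V] {k : ℕ} (hS : ConnectedOn E S)
    (hk : ∀ w ∈ S, k ≤ hdeg E S w) : ∃ T, S ⊆ T ∧ IsQuark E k T := by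
  obtain ⟨T, hST, hT⟩ := (Set.toFinite
    {T : Finset V | ConnectedOn E T ∧ ∀ w ∈ T, k ≤ hdeg E T w}).exists_le_maximal ⟨hS, hk⟩
  exact ⟨T, hST, hT.prop.1, hT.prop.2, fun U hTU hU hUk => (hT.eq_of_le ⟨hU, hUk⟩ hTU).symm⟩

end Hypergraph

/-- correctness of the peeling algorithm: if `v 0, …, v (n-1)` is an ordering
of the nodes such that each `v i` has minimum degree in the hypergraph induced on
`S i = {v i, v (i+1), …, v (n-1)}`, then the quark number of `v i` equals the running maximum
`max_{j ≤ i} d_{S j}(v j)` of the peeled degrees. -/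
theorem stmt_9 [Fintype V] [DecidableEq V] (E : Finset (Finset V)) (n : ℕ)
    (hn : Fintype.card V = n) (v : Fin n → V) (hv : Function.Bijective v)
    (S : Fin n → Finset V)
    (hS : ∀ i, S i = Finset.image v (Finset.univ.filter fun j => i ≤ j))
    (hmin : ∀ i, ∀ w ∈ S i, hdeg E (S i) (v i) ≤ hdeg E (S i) w) :
    ∀ i : Fin n, quarkNum E (v i) =
      (Finset.univ.filter fun j => j ≤ i).sup fun j => hdeg E (S j) (v j) := by
  intro i
  have hmem : ∀ a b, v a ∈ S b ↔ b ≤ a := fun a b => by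
    simp [hS, hv.injective.eq_iff]
  have hub : ∀ k ∈ {k : ℕ | ∃ Q : Finset V, IsQuark E k Q ∧ v i ∈ Q},
      k ≤ (Finset.univ.filter fun j => j ≤ i).sup fun j => hdeg E (S j) (v j) := by
    rintro k ⟨Q, hQ, hiQ⟩
    obtain ⟨j, hj, hjmin⟩ := (Finset.univ.filter fun j => v j ∈ Q).exists_min_image id
      ⟨i, by simpa using hiQ⟩
    have hle : ∀ a, v a ∈ Q → j ≤ a := fun a ha => hjmin a (by simpa using ha)
    have hjQ : v j ∈ Q := by simpa using hj
    have hsub : Q ⊆ S j := fun x hx => by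
      obtain ⟨a, rfl⟩ := hv.surjective x
      exact (hmem a j).2 (hle a hx)
    exact ((hQ.2.1 _ hjQ).trans (hdeg_mono hsub _)).trans
      (Finset.le_sup (f := fun j => hdeg E (S j) (v j)) (by simpa using hle i hiQ))
  apply le_antisymm
  · rw [quarkNum]
    rcases Set.eq_empty_or_nonempty {k : ℕ | ∃ Q : Finset V, IsQuark E k Q ∧ v i ∈ Q} with h | h
    · simp [h]
    · exact csSup_le h hub
  · refine Finset.sup_le fun j hj => ?_
    have hji : j ≤ i := by simpa using hj
    rcases Nat.eq_zero_or_pos (hdeg E (S j) (v j)) with h | h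
    · simp [h]
    · obtain ⟨C, hiC, hC, hCk⟩ := exists_connectedOn_of_le_hdeg h (hmin j) ((hmem i j).2 hji)
      obtain ⟨Q, hCQ, hQ⟩ := exists_isQuark_superset hC hCk
      exact le_csSup ⟨_, hub⟩ ⟨Q, hQ, hCQ hiC⟩
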